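/- (Theorem 1.3) Let s, t > 0. A triple (k, l, m) is μ_{s,t}-stable (resp. μ_{s,t}-semistable) if and only if for all subspaces U_1 ⊆ U and V_1 ⊆ V the following two conditions hold: (1) if (U_1, V_1) ≠ (0, 0) and k(U_1) + l(U_1) ⊆ V_1, then s·dim V_1 > t·dim U_1 (resp. s·dim V_1 ≥ t·dim U_1); (2) if (U_1, V_1) ≠ (U, V), k(U_1) + l(U_1) ⊆ V_1, and range(m) ⊆ V_1, then t·dim(U/U_1) > s·dim(V/V_1) (resp. t·dim(U/U_1) ≥ s·dim(V/V_1)). -/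

import Mathlib

open LinearMap Module Submodule

noncomputable section

/-- The sum of the eigenspaces of `ξ` for (real) eigenvalues `≤ lam`. -/
def eigFilt {E : Type*} [NormedAddCommGroup E] [InnerProductSpace ℂ E]
    (ξ : E →ₗ[ℂ] E) (lam : ℝ) : Submodule ℂ E :=
  ⨆ (μ : ℝ) (_ : μ ≤ lam), Module.End.eigenspace (ξ : Module.End ℂ E) (μ : ℂ)

variable {U V W : Type*}
  [NormedAddCommGroup U] [InnerProductSpace ℂ U] [FiniteDimensional ℂ U]
  [NormedAddCommGroup V] [InnerProductSpace ℂ V] [FiniteDimensional ℂ V]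
  [NormedAddCommGroup W] [InnerProductSpace ℂ W] [FiniteDimensional ℂ W]

/-- The spectral condition on `((k,l,m), (ξ_U, ξ_V))`: `k(U_λ) ⊆ V_λ` and
`l(U_λ) ⊆ V_λ` for all `λ ∈ ℝ`, and `range m ⊆ V_0`. -/
def TripleSpectralCond (k l : U →ₗ[ℂ] V) (m : W →ₗ[ℂ] V)
    (ξU : U →ₗ[ℂ] U) (ξV : V →ₗ[ℂ] V) : Prop :=
  (∀ lam : ℝ, (eigFilt ξU lam).map k ≤ eigFilt ξV lam) ∧
  (∀ lam : ℝ, (eigFilt ξU lam).map l ≤ eigFilt ξV lam) ∧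
  LinearMap.range m ≤ eigFilt ξV 0

/-- `μ_{s,t}`-stability of a triple `(k,l,m)`. -/
def MuStableTriple (s t : ℝ) (k l : U →ₗ[ℂ] V) (m : W →ₗ[ℂ] V) : Prop :=
  ∀ (ξU : U →ₗ[ℂ] U) (ξV : V →ₗ[ℂ] V), ξU.IsSymmetric → ξV.IsSymmetric →
    TripleSpectralCond k l m ξU ξV → ¬(ξU = 0 ∧ ξV = 0) →
    0 < t * (LinearMap.trace ℂ U ξU).re - s * (LinearMap.trace ℂ V ξV).re

/-- `μ_{s,t}`-semistability of a triple `(k,l,m)`. -/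
def MuSemistableTriple (s t : ℝ) (k l : U →ₗ[ℂ] V) (m : W →ₗ[ℂ] V) : Prop :=
  ∀ (ξU : U →ₗ[ℂ] U) (ξV : V →ₗ[ℂ] V), ξU.IsSymmetric → ξV.IsSymmetric →
    TripleSpectralCond k l m ξU ξV → ¬(ξU = 0 ∧ ξV = 0) →
    0 ≤ t * (LinearMap.trace ℂ U ξU).re - s * (LinearMap.trace ℂ V ξV).re

section Helpers

variable {E : Type*} [NormedAddCommGroup E] [InnerProductSpace ℂ E]

lemma eigFilt_mono (ξ : E →ₗ[ℂ] E) {a b : ℝ} (h : a ≤ b) : eigFilt ξ a ≤ eigFilt ξ b := by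
  unfold eigFilt
  refine iSup₂_le fun μ hμ => ?_
  exact le_iSup₂_of_le μ (hμ.trans h) le_rfl

lemma eigenspace_le_eigFilt (ξ : E →ₗ[ℂ] E) {a b : ℝ} (h : a ≤ b) :
    Module.End.eigenspace (ξ : Module.End ℂ E) (a : ℂ) ≤ eigFilt ξ b :=
  le_iSup₂_of_le (f := fun (μ : ℝ) (_ : μ ≤ b) =>
    Module.End.eigenspace (ξ : Module.End ℂ E) (μ : ℂ)) a h le_rfl

variable [FiniteDimensional ℂ E]

/-- `b • id` minus the orthogonal projection onto `K`. -/
def shiftProj (b : ℝ) (K : Submodule ℂ E) : E →ₗ[ℂ] E :=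
  (b : ℂ) • LinearMap.id - (K.starProjection : E →ₗ[ℂ] E)

lemma shiftProj_apply (b : ℝ) (K : Submodule ℂ E) (x : E) :
    shiftProj b K x = (b : ℂ) • x - K.starProjection x := by
  simp [shiftProj]

lemma shiftProj_symm (b : ℝ) (K : Submodule ℂ E) : (shiftProj b K).IsSymmetric := by
  intro x y
  simp only [shiftProj_apply, inner_sub_left, inner_sub_right, inner_smul_left, inner_smul_right,
    inner_starProjection_left_eq_right]
  simp

lemma shiftProj_trace (b : ℝ) (K : Submodule ℂ E) :
    (LinearMap.trace ℂ E (shiftProj b K)).re = b * finrank ℂ E - finrank ℂ K := by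
  have hp : LinearMap.IsProj K (K.starProjection : E →ₗ[ℂ] E) :=
    ⟨fun x => starProjection_apply_mem K x, fun x hx => starProjection_eq_self_iff.2 hx⟩
  have := hp.trace
  unfold shiftProj
  rw [map_sub, map_smul, LinearMap.trace_id, this]
  simp

lemma shiftProj_zero_eq (K : Submodule ℂ E) (h : shiftProj 0 K = 0) : K = ⊥ := by
  rw [eq_bot_iff]
  intro x hx
  have h1 := LinearMap.congr_fun h x
  rw [shiftProj_apply, starProjection_eq_self_iff.2 hx] at h1
  simpa using h1

lemma shiftProj_one_eq (K : Submodule ℂ E) (h : shiftProj 1 K = 0) : K = ⊤ := by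
  rw [eq_top_iff]
  intro x _
  have h1 := LinearMap.congr_fun h x
  rw [shiftProj_apply] at h1
  simp only [Complex.ofReal_one, one_smul, LinearMap.zero_apply, sub_eq_zero] at h1
  exact starProjection_eq_self_iff.1 h1.symm

lemma shiftProj_le_of_lt {b lam : ℝ} (K : Submodule ℂ E) (h : lam < b) :
    eigFilt (shiftProj b K) lam ≤ K := by
  refine iSup₂_le fun μ hμ x hx => ?_
  rw [Module.End.mem_eigenspace_iff, shiftProj_apply] at hx
  have hne : (b : ℂ) - μ ≠ 0 := by
    rw [sub_ne_zero]; exact_mod_cast (by linarith : μ < b).ne'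
  have h2 : ((b : ℂ) - μ) • x ∈ K := by
    have : ((b : ℂ) - μ) • x = K.starProjection x := by
      rw [sub_smul, ← hx]; abel
    rw [this]; exact starProjection_apply_mem K x
  exact (K.smul_mem_iff hne).1 h2

lemma shiftProj_bot_of_lt {b lam : ℝ} (K : Submodule ℂ E) (h : lam < b - 1) :
    eigFilt (shiftProj b K) lam = ⊥ := by
  rw [eq_bot_iff]
  refine iSup₂_le fun μ hμ x hx => ?_
  have hxK : x ∈ K := shiftProj_le_of_lt K (by linarith : μ < b)
    (eigenspace_le_eigFilt _ le_rfl hx)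
  rw [Module.End.mem_eigenspace_iff, shiftProj_apply, starProjection_eq_self_iff.2 hxK] at hx
  have hne : (b : ℂ) - 1 - μ ≠ 0 := by
    rw [sub_ne_zero]; exact_mod_cast (by linarith : μ < b - 1).ne'
  have : ((b : ℂ) - 1 - μ) • x = 0 := by
    rw [sub_smul, sub_smul, one_smul, hx, sub_self]
  exact (smul_eq_zero.1 this).resolve_left hne

lemma le_shiftProj {b lam : ℝ} (K : Submodule ℂ E) (h : b - 1 ≤ lam) :
    K ≤ eigFilt (shiftProj b K) lam := by
  refine le_trans (fun x hx => ?_) (eigenspace_le_eigFilt _ h)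
  rw [Module.End.mem_eigenspace_iff, shiftProj_apply, starProjection_eq_self_iff.2 hx]
  push_cast
  rw [sub_smul, one_smul]

lemma shiftProj_top {b lam : ℝ} (K : Submodule ℂ E) (h : b ≤ lam) :
    eigFilt (shiftProj b K) lam = ⊤ := by
  rw [eq_top_iff, ← Submodule.sup_orthogonal_of_hasOrthogonalProjection (K := K)]
  refine sup_le (le_shiftProj K (by linarith)) ?_
  refine le_trans (fun x hx => ?_) (eigenspace_le_eigFilt _ h)
  rw [Module.End.mem_eigenspace_iff, shiftProj_apply, (starProjection_apply_eq_zero_iff K).2 hx,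
    sub_zero]

lemma shiftProj_map {F : Type*} [NormedAddCommGroup F] [InnerProductSpace ℂ F]
    [FiniteDimensional ℂ F] (b lam : ℝ) (K : Submodule ℂ E) (L : Submodule ℂ F)
    (k : E →ₗ[ℂ] F) (h : K.map k ≤ L) :
    (eigFilt (shiftProj b K) lam).map k ≤ eigFilt (shiftProj b L) lam := by
  rcases lt_or_ge lam (b - 1) with h1 | h1
  · rw [shiftProj_bot_of_lt K h1]; simp
  rcases lt_or_ge lam b with h2 | h2
  · exact (Submodule.map_mono (shiftProj_le_of_lt K h2)).trans (h.trans (le_shiftProj L h1))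
  · rw [shiftProj_top L h2]; exact le_top

lemma eigFilt_eq_span {ξ : E →ₗ[ℂ] E} (hξ : ξ.IsSymmetric) (lam : ℝ) :
    eigFilt ξ lam = span ℂ (Set.range fun i : {i // hξ.eigenvalues rfl i ≤ lam} =>
      hξ.eigenvectorBasis rfl i.1) := by
  apply le_antisymm
  · refine iSup₂_le fun μ hμ x hx => ?_
    rw [Module.End.mem_eigenspace_iff] at hx
    rw [← (hξ.eigenvectorBasis rfl).sum_repr x]
    refine Submodule.sum_mem _ fun i _ => ?_
    have h1 := hξ.eigenvectorBasis_apply_self_apply rfl x i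
    rw [hx] at h1
    simp only [map_smul, PiLp.smul_apply, smul_eq_mul] at h1
    by_cases h0 : (hξ.eigenvectorBasis rfl).repr x i = 0
    · rw [h0, zero_smul]; exact Submodule.zero_mem _
    · have h2 := mul_right_cancel₀ h0 h1
      have h3 : μ = hξ.eigenvalues rfl i := Complex.ofReal_injective h2
      exact Submodule.smul_mem _ _ (Submodule.subset_span ⟨⟨i, h3 ▸ hμ⟩, rfl⟩)
  · rw [Submodule.span_le]
    rintro _ ⟨⟨i, hi⟩, rfl⟩
    refine eigenspace_le_eigFilt ξ hi ?_
    rw [Module.End.mem_eigenspace_iff]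
    exact hξ.apply_eigenvectorBasis rfl i

lemma finrank_eigFilt {ξ : E →ₗ[ℂ] E} (hξ : ξ.IsSymmetric) (lam : ℝ) :
    (finrank ℂ (eigFilt ξ lam) : ℝ) =
      ∑ i, if hξ.eigenvalues rfl i ≤ lam then (1 : ℝ) else 0 := by
  classical
  rw [eigFilt_eq_span hξ, finrank_span_eq_card, Fintype.card_subtype, Finset.sum_boole]
  exact (hξ.eigenvectorBasis rfl).orthonormal.linearIndependent.comp _ Subtype.val_injective

lemma finrank_quot_eigFilt {ξ : E →ₗ[ℂ] E} (hξ : ξ.IsSymmetric) (lam : ℝ) :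
    (finrank ℂ (E ⧸ eigFilt ξ lam) : ℝ) =
      ∑ i, if lam < hξ.eigenvalues rfl i then (1 : ℝ) else 0 := by
  have h1 := (eigFilt ξ lam).finrank_quotient_add_finrank
  have h2 : (finrank ℂ (E ⧸ eigFilt ξ lam) : ℝ) + finrank ℂ (eigFilt ξ lam) = finrank ℂ E := by
    exact_mod_cast h1
  rw [finrank_eigFilt hξ] at h2
  have h3 : (∑ i, if lam < hξ.eigenvalues rfl i then (1 : ℝ) else 0) +
      (∑ i, if hξ.eigenvalues rfl i ≤ lam then (1 : ℝ) else 0) = finrank ℂ E := by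
    rw [← Finset.sum_add_distrib]
    have : ∀ i, ((if lam < hξ.eigenvalues rfl i then (1 : ℝ) else 0) +
        if hξ.eigenvalues rfl i ≤ lam then (1 : ℝ) else 0) = 1 := by
      intro i
      rcases lt_or_ge lam (hξ.eigenvalues rfl i) with h | h
      · simp [h, not_le.2 h]
      · simp [h, not_lt.2 h]
    simp [this]
  linarith

/-- Signed dimension function of the filtration. -/
def sgnDim (ξ : E →ₗ[ℂ] E) (lam : ℝ) : ℝ :=
  if 0 ≤ lam then (finrank ℂ (E ⧸ eigFilt ξ lam) : ℝ) else -(finrank ℂ (eigFilt ξ lam) : ℝ)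

lemma sgnDim_eq {ξ : E →ₗ[ℂ] E} (hξ : ξ.IsSymmetric) :
    sgnDim ξ = fun lam => ∑ i, ((Set.Ico 0 (hξ.eigenvalues rfl i)).indicator (1 : ℝ → ℝ) lam
      - (Set.Ico (hξ.eigenvalues rfl i) 0).indicator (1 : ℝ → ℝ) lam) := by
  funext lam
  unfold sgnDim
  split_ifs with h
  · rw [finrank_quot_eigFilt hξ]
    refine Finset.sum_congr rfl fun i _ => ?_
    simp [Set.indicator_apply, h, not_lt.2 h]
  · rw [finrank_eigFilt hξ, ← Finset.sum_neg_distrib]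
    refine Finset.sum_congr rfl fun i _ => ?_
    simp [Set.indicator_apply, h, not_le.1 h]

lemma integrable_ico (a b : ℝ) :
    MeasureTheory.Integrable ((Set.Ico a b).indicator (1 : ℝ → ℝ)) := by
  refine (MeasureTheory.integrable_indicator_iff measurableSet_Ico).2 ?_
  exact MeasureTheory.integrableOn_const (by simp) (by simp)

lemma sgnDim_integrable {ξ : E →ₗ[ℂ] E} (hξ : ξ.IsSymmetric) :
    MeasureTheory.Integrable (sgnDim ξ) := by
  rw [sgnDim_eq hξ]
  exact MeasureTheory.integrable_finsetSum _ fun i _ =>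
    (integrable_ico _ _).sub (integrable_ico _ _)

lemma sgnDim_integral {ξ : E →ₗ[ℂ] E} (hξ : ξ.IsSymmetric) :
    ∫ lam, sgnDim ξ lam = (LinearMap.trace ℂ E ξ).re := by
  have h := hξ.re_trace_eq_sum_eigenvalues (rfl : finrank ℂ E = _)
  rw [sgnDim_eq hξ]
  refine Eq.trans ?_ h.symm
  refine (MeasureTheory.integral_finsetSum _ fun i _ =>
    (integrable_ico 0 (hξ.eigenvalues rfl i)).sub (integrable_ico (hξ.eigenvalues rfl i) 0)).trans ?_
  refine Finset.sum_congr rfl fun i _ => ?_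
  rw [MeasureTheory.integral_sub' (integrable_ico _ _) (integrable_ico _ _),
    MeasureTheory.integral_indicator_one measurableSet_Ico,
    MeasureTheory.integral_indicator_one measurableSet_Ico]
  simp only [MeasureTheory.measureReal_def, Real.volume_Ico, ENNReal.toReal_ofReal']
  rcases le_total 0 (hξ.eigenvalues rfl i) with h0 | h0
  · simp [h0]
  · simp [h0]

/-- A nonzero symmetric operator has nontrivial filtration on an interval. -/
lemma exists_interval {ξ : E →ₗ[ℂ] E} (hξ : ξ.IsSymmetric) (h0 : ξ ≠ 0) :
    ∃ c d : ℝ, c < d ∧ ∀ lam ∈ Set.Ico c d,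
      (0 ≤ lam ∧ eigFilt ξ lam ≠ ⊤) ∨ (lam < 0 ∧ eigFilt ξ lam ≠ ⊥) := by
  have : ∃ i, hξ.eigenvalues rfl i ≠ 0 := by
    by_contra! hc
    apply h0
    refine (hξ.eigenvectorBasis rfl).toBasis.ext fun i => ?_
    simp [hc i]
  obtain ⟨i, hi⟩ := this
  rcases lt_or_gt_of_ne hi with h | h
  · refine ⟨_, 0, h, fun lam hl => Or.inr ⟨hl.2, fun hb => ?_⟩⟩
    have h1 := finrank_eigFilt hξ lam
    rw [hb, finrank_bot] at h1
    have h2 := Finset.single_le_sum (f := fun i => if hξ.eigenvalues rfl i ≤ lam then (1 : ℝ) else 0)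
      (fun j _ => by split_ifs <;> norm_num) (Finset.mem_univ i)
    simp only [hl.1, if_true] at h2
    rw [Nat.cast_zero] at h1
    linarith
  · refine ⟨0, _, h, fun lam hl => Or.inl ⟨hl.1, fun hb => ?_⟩⟩
    have h1 := finrank_quot_eigFilt hξ lam
    have h3 := (eigFilt ξ lam).finrank_quotient_add_finrank
    rw [hb, finrank_top] at h3
    rw [hb, (by omega : finrank ℂ (E ⧸ (⊤ : Submodule ℂ E)) = 0)] at h1
    have h2 := Finset.single_le_sum (f := fun i => if lam < hξ.eigenvalues rfl i then (1 : ℝ) else 0)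
      (fun j _ => by split_ifs <;> norm_num) (Finset.mem_univ i)
    simp only [hl.2, if_true] at h2
    rw [Nat.cast_zero] at h1
    linarith

end Helpers

lemma spectral_shiftProj (k l : U →ₗ[ℂ] V) (m : W →ₗ[ℂ] V) (b : ℝ)
    (U₁ : Submodule ℂ U) (V₁ : Submodule ℂ V) (h : U₁.map k ⊔ U₁.map l ≤ V₁)
    (hm : b ≤ 0 ∨ (b ≤ 1 ∧ LinearMap.range m ≤ V₁)) :
    TripleSpectralCond k l m (shiftProj b U₁) (shiftProj b V₁) := by
  refine ⟨fun lam => shiftProj_map b lam _ _ k (le_sup_left.trans h),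
    fun lam => shiftProj_map b lam _ _ l (le_sup_right.trans h), ?_⟩
  rcases hm with hb | ⟨hb, hm⟩
  · rw [shiftProj_top V₁ hb]; exact le_top
  · exact hm.trans (le_shiftProj V₁ (by linarith))

lemma integral_formula {ξU : U →ₗ[ℂ] U} {ξV : V →ₗ[ℂ] V} (hU : ξU.IsSymmetric)
    (hV : ξV.IsSymmetric) (s t : ℝ) :
    t * (LinearMap.trace ℂ U ξU).re - s * (LinearMap.trace ℂ V ξV).re =
      ∫ lam, (t * sgnDim ξU lam - s * sgnDim ξV lam) := by
  rw [MeasureTheory.integral_sub ((sgnDim_integrable hU).const_mul t)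
    ((sgnDim_integrable hV).const_mul s), MeasureTheory.integral_const_mul,
    MeasureTheory.integral_const_mul, sgnDim_integral hU, sgnDim_integral hV]

lemma quot_eq (K : Submodule ℂ U) : (finrank ℂ (U ⧸ K) : ℝ) = finrank ℂ U - finrank ℂ K := by
  have h1 := K.finrank_quotient_add_finrank
  have h2 : (finrank ℂ (U ⧸ K) : ℝ) + finrank ℂ K = finrank ℂ U := by exact_mod_cast h1
  linarith

/-- Pointwise nonnegativity of the integrand under the (semistable) subspace conditions. -/
lemma integrand_nonneg (s t : ℝ) (k l : U →ₗ[ℂ] V) (m : W →ₗ[ℂ] V)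
    (H1 : ∀ (U₁ : Submodule ℂ U) (V₁ : Submodule ℂ V), ¬(U₁ = ⊥ ∧ V₁ = ⊥) →
          U₁.map k ⊔ U₁.map l ≤ V₁ →
          t * (finrank ℂ U₁ : ℝ) ≤ s * (finrank ℂ V₁ : ℝ))
    (H2 : ∀ (U₁ : Submodule ℂ U) (V₁ : Submodule ℂ V), ¬(U₁ = ⊤ ∧ V₁ = ⊤) →
          U₁.map k ⊔ U₁.map l ≤ V₁ → LinearMap.range m ≤ V₁ →
          s * (finrank ℂ (V ⧸ V₁) : ℝ) ≤ t * (finrank ℂ (U ⧸ U₁) : ℝ))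
    {ξU : U →ₗ[ℂ] U} {ξV : V →ₗ[ℂ] V} (hc : TripleSpectralCond k l m ξU ξV) (lam : ℝ) :
    0 ≤ t * sgnDim ξU lam - s * sgnDim ξV lam := by
  have hkl := sup_le (hc.1 lam) (hc.2.1 lam)
  unfold sgnDim
  split_ifs with h
  · by_cases hT : eigFilt ξU lam = ⊤ ∧ eigFilt ξV lam = ⊤
    · rw [quot_eq, quot_eq, hT.1, hT.2, finrank_top, finrank_top]; simp
    · linarith [H2 _ _ hT hkl (hc.2.2.trans (eigFilt_mono _ h))]
  · by_cases hT : eigFilt ξU lam = ⊥ ∧ eigFilt ξV lam = ⊥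
    · rw [hT.1, hT.2, finrank_bot, finrank_bot]; simp
    · linarith [H1 _ _ hT hkl]

/-- **Theorem 1.3.** For `s, t > 0`, a triple `(k, l, m)` is
`μ_{s,t}`-stable (resp. semistable) iff for all subspaces `U₁ ⊆ U`, `V₁ ⊆ V`:
(1) if `(U₁,V₁) ≠ (0,0)` and `k(U₁) + l(U₁) ⊆ V₁` then `s·dim V₁ > t·dim U₁`
(resp. `≥`); (2) if `(U₁,V₁) ≠ (U,V)`, `k(U₁) + l(U₁) ⊆ V₁` and `range m ⊆ V₁`, then
`t·dim(U/U₁) > s·dim(V/V₁)` (resp. `≥`). -/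
theorem muStableTriple_iff (r : ℕ)
    (hdim : finrank ℂ V = finrank ℂ U + r) (hrw : r ≤ finrank ℂ W)
    (s t : ℝ) (hs : 0 < s) (ht : 0 < t) (k l : U →ₗ[ℂ] V) (m : W →ₗ[ℂ] V) :
    (MuStableTriple s t k l m ↔
      ((∀ (U₁ : Submodule ℂ U) (V₁ : Submodule ℂ V), ¬(U₁ = ⊥ ∧ V₁ = ⊥) →
          U₁.map k ⊔ U₁.map l ≤ V₁ →
          t * (finrank ℂ U₁ : ℝ) < s * (finrank ℂ V₁ : ℝ)) ∧
       (∀ (U₁ : Submodule ℂ U) (V₁ : Submodule ℂ V), ¬(U₁ = ⊤ ∧ V₁ = ⊤) →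
          U₁.map k ⊔ U₁.map l ≤ V₁ → LinearMap.range m ≤ V₁ →
          s * (finrank ℂ (V ⧸ V₁) : ℝ) < t * (finrank ℂ (U ⧸ U₁) : ℝ)))) ∧
    (MuSemistableTriple s t k l m ↔
      ((∀ (U₁ : Submodule ℂ U) (V₁ : Submodule ℂ V), ¬(U₁ = ⊥ ∧ V₁ = ⊥) →
          U₁.map k ⊔ U₁.map l ≤ V₁ →
          t * (finrank ℂ U₁ : ℝ) ≤ s * (finrank ℂ V₁ : ℝ)) ∧
       (∀ (U₁ : Submodule ℂ U) (V₁ : Submodule ℂ V), ¬(U₁ = ⊤ ∧ V₁ = ⊤) →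
          U₁.map k ⊔ U₁.map l ≤ V₁ → LinearMap.range m ≤ V₁ →
          s * (finrank ℂ (V ⧸ V₁) : ℝ) ≤ t * (finrank ℂ (U ⧸ U₁) : ℝ)))) := by
  have key1 : ∀ (U₁ : Submodule ℂ U) (V₁ : Submodule ℂ V), ¬(U₁ = ⊥ ∧ V₁ = ⊥) →
      ¬ (shiftProj 0 U₁ = 0 ∧ shiftProj 0 V₁ = 0) :=
    fun U₁ V₁ h h' => h ⟨shiftProj_zero_eq _ h'.1, shiftProj_zero_eq _ h'.2⟩
  have key2 : ∀ (U₁ : Submodule ℂ U) (V₁ : Submodule ℂ V), ¬(U₁ = ⊤ ∧ V₁ = ⊤) →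
      ¬ (shiftProj 1 U₁ = 0 ∧ shiftProj 1 V₁ = 0) :=
    fun U₁ V₁ h h' => h ⟨shiftProj_one_eq _ h'.1, shiftProj_one_eq _ h'.2⟩
  refine ⟨⟨fun H => ⟨fun U₁ V₁ h0 h => ?_, fun U₁ V₁ h0 h hm => ?_⟩, ?_⟩,
    ⟨fun H => ⟨fun U₁ V₁ h0 h => ?_, fun U₁ V₁ h0 h hm => ?_⟩, ?_⟩⟩
  · have := H _ _ (shiftProj_symm 0 U₁) (shiftProj_symm 0 V₁)
      (spectral_shiftProj k l m 0 U₁ V₁ h (Or.inl le_rfl)) (key1 _ _ h0)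
    rw [shiftProj_trace, shiftProj_trace] at this
    linarith
  · have := H _ _ (shiftProj_symm 1 U₁) (shiftProj_symm 1 V₁)
      (spectral_shiftProj k l m 1 U₁ V₁ h (Or.inr ⟨le_rfl, hm⟩)) (key2 _ _ h0)
    rw [shiftProj_trace, shiftProj_trace, one_mul, one_mul, ← quot_eq, ← quot_eq] at this
    linarith
  · rintro ⟨H1, H2⟩ ξU ξV hU hV hc hne
    rw [integral_formula hU hV]
    have hnn := integrand_nonneg s t k l m (fun _ _ a b => (H1 _ _ a b).le)
      (fun _ _ a b c => (H2 _ _ a b c).le) hc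
    rw [MeasureTheory.integral_pos_iff_support_of_nonneg hnn
      (((sgnDim_integrable hU).const_mul t).sub ((sgnDim_integrable hV).const_mul s))]
    have hex : ∃ c d : ℝ, c < d ∧ ∀ lam ∈ Set.Ico c d,
        (0 ≤ lam ∧ ¬ (eigFilt ξU lam = ⊤ ∧ eigFilt ξV lam = ⊤)) ∨
        (lam < 0 ∧ ¬ (eigFilt ξU lam = ⊥ ∧ eigFilt ξV lam = ⊥)) := by
      by_cases h0 : ξU = 0
      · obtain ⟨c, d, hcd, h⟩ := exists_interval hV (fun h => hne ⟨h0, h⟩)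
        exact ⟨c, d, hcd, fun lam hl => (h lam hl).imp
          (fun a => ⟨a.1, fun b => a.2 b.2⟩) (fun a => ⟨a.1, fun b => a.2 b.2⟩)⟩
      · obtain ⟨c, d, hcd, h⟩ := exists_interval hU h0
        exact ⟨c, d, hcd, fun lam hl => (h lam hl).imp
          (fun a => ⟨a.1, fun b => a.2 b.1⟩) (fun a => ⟨a.1, fun b => a.2 b.1⟩)⟩
    obtain ⟨c, d, hcd, h⟩ := hex
    have hpos : 0 < MeasureTheory.volume (Set.Ico c d) := by
      rw [Real.volume_Ico]; simpa using hcd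
    refine lt_of_lt_of_le hpos (MeasureTheory.measure_mono fun lam hl => ?_)
    have hkl := sup_le (hc.1 lam) (hc.2.1 lam)
    rw [Function.mem_support]
    apply ne_of_gt
    unfold sgnDim
    rcases h lam hl with ⟨h1, h2⟩ | ⟨h1, h2⟩
    · rw [if_pos h1, if_pos h1]
      linarith [H2 _ _ h2 hkl (hc.2.2.trans (eigFilt_mono _ h1))]
    · rw [if_neg (not_le.2 h1), if_neg (not_le.2 h1)]
      linarith [H1 _ _ h2 hkl]
  · have := H _ _ (shiftProj_symm 0 U₁) (shiftProj_symm 0 V₁)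
      (spectral_shiftProj k l m 0 U₁ V₁ h (Or.inl le_rfl)) (key1 _ _ h0)
    rw [shiftProj_trace, shiftProj_trace] at this
    linarith
  · have := H _ _ (shiftProj_symm 1 U₁) (shiftProj_symm 1 V₁)
      (spectral_shiftProj k l m 1 U₁ V₁ h (Or.inr ⟨le_rfl, hm⟩)) (key2 _ _ h0)
    rw [shiftProj_trace, shiftProj_trace, one_mul, one_mul, ← quot_eq, ← quot_eq] at this
    linarith
  · rintro ⟨H1, H2⟩ ξU ξV hU hV hc hne
    rw [integral_formula hU hV]
    exact MeasureTheory.integral_nonneg (integrand_nonneg s t k l m H1 H2 hc)
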